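/- Let A be an iterated circuit, i.e., an upper diagonal point configuration all of whose diagonal configurations A_1,…,A_m are circuits (each of codimension 1), with A_j of dimension n_j, so n = n_1+…+n_m. Then, for a suitable Gale dual, the coefficient of the monomial t_1^{n_1} t_2^{n_2} ⋯ t_m^{n_m} in the cuspidal form P_A(t) equals the product of the (nonzero) coefficients of the monomial cuspidal forms P_{A_1}(t_1),…,P_{A_m}(t_m); in particular, P_A is not the zero polynomial. -/

import Mathlib

open Matrix MvPolynomial Finset

/-- Squared maximal minor of `Ahat` on the column set `s` (independent of column order). -/
noncomputable def detSq {rho kappa : Type*} [Fintype rho] [Fintype kappa] [DecidableEq kappa]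
    (Ahat : Matrix rho kappa ℝ) (s : Finset kappa) (h : s.card = Fintype.card rho) : ℝ :=
  (Ahat.submatrix (Fintype.equivFin rho).symm
      fun i => ((s.equivFin.symm (Fin.cast h.symm i)) : kappa)).det ^ 2

/-- The cuspidal form `P_A(t) = Σ_{#σ = n} det(Â_σ)² ∏_{k∈σ} ⟨β_k, t⟩`, as a
multivariate polynomial in the variables `t`. -/
noncomputable def cuspFormPoly {rho kappa mu : Type*}
    [Fintype rho] [Fintype kappa] [Fintype mu] [DecidableEq kappa]
    (Ahat : Matrix rho kappa ℝ) (B : Matrix kappa mu ℝ) : MvPolynomial mu ℝ :=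
  ∑ s ∈ (univ.powersetCard (Fintype.card rho)).attach,
    C (detSq Ahat s.1 (mem_powersetCard.mp s.2).2) *
      ∏ k ∈ s.1, ∑ l, C (B k l) * X l

/-- `B` is a Gale dual of `A`: it has full column rank and `A * B = 0`. -/
def IsGaleDual {rho kappa mu : Type*} [Fintype rho] [Fintype kappa] [Fintype mu]
    (A : Matrix rho kappa ℝ) (B : Matrix kappa mu ℝ) : Prop :=
  B.rank = Fintype.card mu ∧ A * B = 0

/-- `A` is a pyramid: all columns but one span a subspace of dimension at most
(number of rows minus one). -/
def IsPyramid {rho kappa : Type*} [Fintype rho] (A : Matrix rho kappa ℝ) : Prop :=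
  ∃ j : kappa, Module.finrank ℝ
      (Submodule.span ℝ ((fun k => fun i => A i k) '' {k | k ≠ j})) ≤ Fintype.card rho - 1


/-- The point configuration with first row all ones, first column `(1,0,…,0)ᵀ` and
remaining block the given matrix `M`. -/
def diagConfig {a b : ℕ} (M : Matrix (Fin a) (Fin b) ℝ) :
    Matrix (Option (Fin a)) (Option (Fin b)) ℝ :=
  Matrix.of fun i k =>
    match i, k with
    | none, _ => 1
    | some _, none => 0
    | some p, some q => M p q

/-- The diagonal point configuration assembled from the blocks `At j`. -/
def bigDiagConfig {r : ℕ} {nn NN : Fin r → ℕ}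
    (At : ∀ j, Matrix (Fin (nn j)) (Fin (NN j)) ℝ) :
    Matrix (Option (Σ j, Fin (nn j))) (Option (Σ j, Fin (NN j))) ℝ :=
  Matrix.of fun i k =>
    match i, k with
    | none, _ => 1
    | some _, none => 0
    | some ⟨j, p⟩, some ⟨j', q⟩ => if h : j = j' then At j' (h ▸ p) q else 0


lemma cb_fiber {rho kappa R : Type*} [Fintype rho] [DecidableEq rho] [Fintype kappa]
    [DecidableEq kappa] [CommRing R] (M : Matrix rho kappa R) (d : kappa → R) (s : Finset kappa)
    (g : rho → kappa) (hg : Function.Injective g) (hgs : univ.image g = s) :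
    ∑ f : rho → kappa with univ.image f = s,
        (∏ x, M x (f x) * d (f x)) * (Matrix.of fun x y => M y (f x)).det
      = (M.submatrix id g).det ^ 2 * ∏ k ∈ s, d k := by
  have h1 : ∑ f : rho → kappa with univ.image f = s,
        (∏ x, M x (f x) * d (f x)) * (Matrix.of fun x y => M y (f x)).det
      = ∑ σ : Equiv.Perm rho, (∏ x, M x (g (σ x)) * d (g (σ x))) *
          (Matrix.of fun x y => M y (g (σ x))).det := by
    symm
    refine Finset.sum_bij (fun σ _ => fun x => g (σ x)) ?_ ?_ ?_ ?_
    · intro σ _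
      simp only [mem_filter, mem_univ, true_and]
      rw [← hgs]
      ext k
      simp only [mem_image, mem_univ, true_and]
      constructor
      · rintro ⟨x, rfl⟩; exact ⟨_, rfl⟩
      · rintro ⟨x, rfl⟩; exact ⟨σ.symm x, by simp⟩
    · intro σ _ τ _ h
      ext x
      exact hg (congrFun h x)
    · intro f hf
      simp only [mem_filter, mem_univ, true_and] at hf
      have hex : ∀ x, ∃ y, g y = f x := by
        intro x
        have : f x ∈ univ.image g := by
          rw [hgs, ← hf]; exact mem_image_of_mem _ (mem_univ _)
        simpa using this
      choose t ht using hex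
      have hsurj : Function.Surjective t := by
        intro y
        have : g y ∈ univ.image f := by
          rw [hf, ← hgs]; exact mem_image_of_mem _ (mem_univ _)
        obtain ⟨x, -, hx⟩ := mem_image.mp this
        exact ⟨x, hg (by rw [ht, hx])⟩
      refine ⟨Equiv.ofBijective t (Finite.surjective_iff_bijective.mp hsurj), mem_univ _, ?_⟩
      funext x
      exact ht x
    · intros; rfl
  rw [h1]
  have h2 : ∀ σ : Equiv.Perm rho, (∏ x, M x (g (σ x)) * d (g (σ x))) *
          (Matrix.of fun x y => M y (g (σ x))).det
      = (∏ k ∈ s, d k) * (M.submatrix id g).det *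
        ((Equiv.Perm.sign σ : ℤ) * ∏ x, M x (g (σ x))) := by
    intro σ
    have e1 : (Matrix.of fun x y => M y (g (σ x))) = ((M.submatrix id g)ᵀ).submatrix σ id := by
      ext x y; rfl
    have e2 : ∏ x, d (g (σ x)) = ∏ k ∈ s, d k := by
      rw [← hgs, Finset.prod_image (fun a _ b _ h => hg h)]
      exact Equiv.prod_comp σ (fun x => d (g x))
    rw [e1, Matrix.det_permute, Matrix.det_transpose, Finset.prod_mul_distrib, e2]
    ring
  simp_rw [h2]
  rw [← Finset.mul_sum]
  have h3 : ∑ σ : Equiv.Perm rho, ((Equiv.Perm.sign σ : ℤ) : R) * ∏ x, M x (g (σ x))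
      = (M.submatrix id g).det := by
    rw [← Matrix.det_transpose, Matrix.det_apply']
    rfl
  rw [h3]; ring

lemma cb_expand {rho kappa R : Type*} [Fintype rho] [DecidableEq rho] [Fintype kappa]
    [DecidableEq kappa] [CommRing R] (M : Matrix rho kappa R) (d : kappa → R) :
    (Matrix.of fun x y => ∑ k, M x k * M y k * d k).det
      = ∑ f : rho → kappa, (∏ x, M x (f x) * d (f x)) * (Matrix.of fun x y => M y (f x)).det := by
  have h := (Matrix.detRowAlternating (R := R) (n := rho)).toMultilinearMap.map_sum
    (fun (x : rho) (k : kappa) => (M x k * d k) • (fun y => M y k : rho → R))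
  have e : (fun x : rho => ∑ k, (M x k * d k) • (fun y => M y k : rho → R))
      = fun x y => ∑ k, M x k * M y k * d k := by
    funext x y
    simp only [Finset.sum_apply, Pi.smul_apply, smul_eq_mul]
    exact Finset.sum_congr rfl fun k _ => by ring
  rw [e] at h
  refine h.trans ?_
  refine Finset.sum_congr rfl fun f _ => ?_
  rw [MultilinearMap.map_smul_univ]
  rfl

lemma cuspFormPoly_eq_det {rho kappa mu : Type*}
    [Fintype rho] [DecidableEq rho] [Fintype kappa] [Fintype mu] [DecidableEq kappa]
    (Ahat : Matrix rho kappa ℝ) (B : Matrix kappa mu ℝ) :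
    cuspFormPoly Ahat B = (Matrix.of fun x y =>
      ∑ l, C (∑ k, Ahat x k * Ahat y k * B k l) * X l : Matrix rho rho (MvPolynomial mu ℝ)).det := by
  have e : (Matrix.of fun x y =>
      ∑ l, C (∑ k, Ahat x k * Ahat y k * B k l) * X l : Matrix rho rho (MvPolynomial mu ℝ))
      = Matrix.of fun x y => ∑ k, (Ahat.map C) x k * (Ahat.map C) y k *
        (∑ l, C (B k l) * X l : MvPolynomial mu ℝ) := by
    ext1 x y
    simp only [Matrix.of_apply, Matrix.map_apply, map_sum, map_mul, Finset.sum_mul, Finset.mul_sum]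
    rw [Finset.sum_comm]
    exact Finset.sum_congr rfl fun k _ => Finset.sum_congr rfl fun l _ => by ring
  rw [e, cb_expand, ← Finset.sum_fiberwise _ (fun f : rho → kappa => univ.image f)]
  unfold cuspFormPoly
  rw [← Finset.sum_subset (Finset.subset_univ (univ.powersetCard (Fintype.card rho)))]
  · rw [← Finset.sum_attach (univ.powersetCard (Fintype.card rho))]
    refine Finset.sum_congr rfl fun s _ => ?_
    have hs := (mem_powersetCard.mp s.2).2
    let eq : rho ≃ s.1 := (Fintype.equivFin rho).trans
      ((finCongr hs.symm).trans s.1.equivFin.symm)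
    rw [cb_fiber (Ahat.map C) (fun k => ∑ l, C (B k l) * X l) s.1 (fun x => (eq x : kappa))
      (fun a b h => eq.injective (Subtype.ext h))]
    · congr 1
      unfold detSq
      rw [map_pow]
      congr 1
      have e2 : Ahat.submatrix (Fintype.equivFin rho).symm
          (fun i => ((s.1.equivFin.symm (Fin.cast hs.symm i)) : kappa))
          = (Ahat.submatrix id (fun x => (eq x : kappa))).submatrix (Fintype.equivFin rho).symm
            (Fintype.equivFin rho).symm := by
        ext i j
        simp [eq]
      rw [e2, Matrix.det_submatrix_equiv_self, RingHom.map_det]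
      rfl
    · ext k
      simp only [mem_image, mem_univ, true_and]
      constructor
      · rintro ⟨x, rfl⟩; exact (eq x).2
      · intro hk; exact ⟨eq.symm ⟨k, hk⟩, by simp⟩
  · intro s _ hs
    refine Finset.sum_eq_zero fun f hf => ?_
    simp only [mem_filter, mem_univ, true_and] at hf
    have hni : ¬ Function.Injective f := by
      intro hi
      apply hs
      rw [mem_powersetCard]
      exact ⟨subset_univ _, by rw [← hf, card_image_of_injective _ hi]; rfl⟩
    simp only [Function.Injective, not_forall] at hni
    obtain ⟨a, b, hab, hne⟩ := hni
    rw [Matrix.det_zero_of_row_eq hne, mul_zero]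
    funext y
    simp [hab]

lemma coeff_prod_lin {rho mu : Type*} [Fintype rho] [DecidableEq rho] [Fintype mu] [DecidableEq mu]
    (c : rho → mu → ℝ) (i : rho → mu) (w : mu → ℕ)
    (hc : ∀ x l, c x l ≠ 0 → l = i x ∨ w (i x) < w l) :
    MvPolynomial.coeff (∑ x, Finsupp.single (i x) 1) (∏ x, ∑ l, C (c x l) * X l)
      = ∏ x, c x (i x) := by
  rw [Fintype.prod_sum, MvPolynomial.coeff_sum, Finset.sum_eq_single i]
  · rw [Finset.prod_mul_distrib, ← map_prod, MvPolynomial.coeff_C_mul]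
    have : (∏ x, X (i x) : MvPolynomial mu ℝ) = monomial (∑ x, Finsupp.single (i x) 1) 1 := by
      rw [MvPolynomial.monomial_sum_one]
      rfl
    rw [this, MvPolynomial.coeff_monomial, if_pos rfl, mul_one]
  · intro f _ hf
    rw [Finset.prod_mul_distrib, ← map_prod, MvPolynomial.coeff_C_mul]
    have : (∏ x, X (f x) : MvPolynomial mu ℝ) = monomial (∑ x, Finsupp.single (f x) 1) 1 := by
      rw [MvPolynomial.monomial_sum_one]
      rfl
    rw [this, MvPolynomial.coeff_monomial]
    split_ifs with h
    · rw [mul_one]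
      by_contra hne
      have hall : ∀ x, c x (f x) ≠ 0 := by
        intro x hx
        exact hne (Finset.prod_eq_zero (mem_univ x) hx)
      have hs : ∑ x, w (f x) = ∑ x, w (i x) := by
        have := congrArg (fun t : mu →₀ ℕ => Finsupp.linearCombination ℕ w t) h
        simpa using this
      have hle : ∀ x ∈ univ, w (i x) ≤ w (f x) := by
        intro x _
        rcases hc x _ (hall x) with h | h
        · rw [h]
        · exact h.le
      have heq := (Finset.sum_eq_sum_iff_of_le hle).mp hs.symm
      apply hf
      funext x
      rcases hc x _ (hall x) with h | h
      · exact h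
      · exact absurd (heq x (mem_univ _)) h.ne
    · rw [mul_zero]
  · intro h; exact absurd (mem_univ _) h

lemma coeff_det_lin {rho mu : Type*} [Fintype rho] [DecidableEq rho] [Fintype mu] [DecidableEq mu]
    (c : rho → rho → mu → ℝ) (i : rho → mu) (w : mu → ℕ)
    (hc : ∀ x y l, c x y l ≠ 0 → l = i x ∨ w (i x) < w l) :
    MvPolynomial.coeff (∑ x, Finsupp.single (i x) 1)
      (Matrix.of fun x y => ∑ l, C (c x y l) * X l : Matrix rho rho (MvPolynomial mu ℝ)).det
      = (Matrix.of fun x y => c x y (i x)).det := by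
  rw [← Matrix.det_transpose, Matrix.det_apply', MvPolynomial.coeff_sum,
    ← Matrix.det_transpose (Matrix.of fun x y => c x y (i x)), Matrix.det_apply']
  refine Finset.sum_congr rfl fun σ _ => ?_
  have : ((Equiv.Perm.sign σ : ℤ) : MvPolynomial mu ℝ) = C (((Equiv.Perm.sign σ : ℤ) : ℝ)) := by
    simp
  rw [this, MvPolynomial.coeff_C_mul]
  congr 1
  exact coeff_prod_lin (fun x l => c x (σ x) l) i w (fun x l => hc x (σ x) l)

lemma circuit_ker {n : ℕ} (M : Matrix (Fin n) (Fin (n + 1)) ℝ) (hp : ¬ IsPyramid (diagConfig M))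
    (x : Option (Fin (n + 1)) → ℝ) (hx : diagConfig M *ᵥ x = 0) (k : Option (Fin (n + 1)))
    (hk : x k = 0) : x = 0 := by
  have hp' : ¬ (Module.finrank ℝ (Submodule.span ℝ
      ((fun k => fun i => diagConfig M i k) '' {l | l ≠ k})) ≤
      Fintype.card (Option (Fin n)) - 1) := fun h => hp ⟨k, h⟩
  simp only [Fintype.card_option, Fintype.card_fin, Nat.add_sub_cancel, not_le] at hp'
  have hr : ((fun k => fun i => diagConfig M i k) '' {l | l ≠ k})
      = Set.range (fun l : {l // l ≠ k} => fun i => diagConfig M i l.1) := by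
    ext v
    simp
  have hli : LinearIndependent ℝ (fun l : {l // l ≠ k} => fun i => diagConfig M i l.1) := by
    rw [linearIndependent_iff_card_le_finrank_span, Set.finrank, ← hr]
    refine le_trans (le_of_eq ?_) hp'
    rw [Fintype.card_subtype_compl]
    simp
  have h0 := (Fintype.linearIndependent_iff.mp hli) (fun l => x l.1) (by
    funext i
    have := congrFun hx i
    simp only [Matrix.mulVec, dotProduct] at this
    rw [← this]
    simp only [Finset.sum_apply, Pi.smul_apply, smul_eq_mul]
    rw [Fintype.sum_eq_add_sum_subtype_ne (fun l => diagConfig M i l * x l) k, hk, mul_zero, zero_add]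
    exact Finset.sum_congr rfl fun l _ => mul_comm _ _)
  funext l
  by_cases hl : l = k
  · rw [hl, hk]; rfl
  · exact h0 ⟨l, hl⟩

lemma circuit_surj {n : ℕ} (M : Matrix (Fin n) (Fin (n + 1)) ℝ)
    (hr : (diagConfig M).rank = n + 1) (y : Fin n → ℝ) : ∃ x, M *ᵥ x = y := by
  have htop : LinearMap.range (diagConfig M).mulVecLin = ⊤ := by
    apply Submodule.eq_top_of_finrank_eq
    rw [← Matrix.rank, hr]
    simp
  obtain ⟨x, hx⟩ := LinearMap.range_eq_top.mp htop (fun o => o.elim 0 y)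
  refine ⟨fun q => x (some q), ?_⟩
  funext p
  have := congrFun hx (some p)
  simpa [Matrix.mulVec, dotProduct, diagConfig, Fintype.sum_option] using this

lemma circuit_det {n : ℕ} (M : Matrix (Fin n) (Fin (n + 1)) ℝ)
    (hr : (diagConfig M).rank = n + 1) (hp : ¬ IsPyramid (diagConfig M))
    (b : Option (Fin (n + 1)) → ℝ) (hb : diagConfig M *ᵥ b = 0) (hb0 : b ≠ 0) :
    (Matrix.of fun p p' => ∑ q, M p q * M p' q * b (some q)).det ≠ 0 := by
  have hbne : ∀ k, b k ≠ 0 := fun k hk => hb0 (circuit_ker M hp b hb k hk)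
  intro hdet
  obtain ⟨v, hv, hMv⟩ := Matrix.exists_mulVec_eq_zero_iff.mpr hdet
  apply hv
  have hMb : ∀ p, ∑ q, M p q * b (some q) = 0 := by
    intro p
    have := congrFun hb (some p)
    simpa [Matrix.mulVec, dotProduct, diagConfig, Fintype.sum_option] using this
  have hz := circuit_ker M hp (fun o => o.elim 0 (fun q => b (some q) * ∑ p, M p q * v p)) (by
    funext i
    rcases i with _ | p
    · simp only [Matrix.mulVec, dotProduct, diagConfig, Fintype.sum_option, Matrix.of_apply,
        Option.elim, one_mul, zero_add, Pi.zero_apply, Finset.mul_sum]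
      rw [Finset.sum_comm]
      refine Finset.sum_eq_zero fun p _ => ?_
      calc ∑ q, b (some q) * (M p q * v p) = (∑ q, M p q * b (some q)) * v p := by
            rw [Finset.sum_mul]; exact Finset.sum_congr rfl fun q _ => by ring
        _ = 0 := by rw [hMb, zero_mul]
    · have := congrFun hMv p
      simp only [Matrix.mulVec, dotProduct, Matrix.of_apply, Pi.zero_apply] at this
      simp only [Matrix.mulVec, dotProduct, diagConfig, Fintype.sum_option, Matrix.of_apply,
        Option.elim, zero_mul, zero_add, Pi.zero_apply, Finset.mul_sum]
      rw [← this, Finset.sum_comm]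
      refine Finset.sum_congr rfl fun p' _ => ?_
      rw [Finset.sum_mul]
      exact Finset.sum_congr rfl fun q _ => by ring) none rfl
  have hu : ∀ q, ∑ p, M p q * v p = 0 := by
    intro q
    have := congrFun hz (some q)
    simpa [hbne] using this
  obtain ⟨x, hx⟩ := circuit_surj M hr v
  have hvv : v ⬝ᵥ v = 0 := by
    have : v ⬝ᵥ (M *ᵥ x) = 0 := by
      rw [Matrix.dotProduct_mulVec]
      have : v ᵥ* M = 0 := by
        funext q
        rw [Pi.zero_apply, ← hu q]
        simp only [Matrix.vecMul, dotProduct]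
        exact Finset.sum_congr rfl fun p _ => by ring
      rw [this, zero_dotProduct]
    rwa [hx] at this
  exact dotProduct_self_eq_zero.mp hvv

lemma circuit_form {n : ℕ} (M : Matrix (Fin n) (Fin (n + 1)) ℝ)
    (b : Matrix (Option (Fin (n + 1))) (Fin 1) ℝ) :
    MvPolynomial.coeff (Finsupp.single (0 : Fin 1) n)
          (cuspFormPoly ((diagConfig M).submatrix some id) b)
      = (Matrix.of fun p p' => ∑ q, M p q * M p' q * b (some q) 0).det := by
  have h := coeff_det_lin (fun p p' l => ∑ k, (diagConfig M).submatrix some id p k *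
    (diagConfig M).submatrix some id p' k * b k l) (fun _ => (0 : Fin 1)) (fun _ => 0)
    (fun x y l _ => Or.inl (Subsingleton.elim _ _))
  rw [cuspFormPoly_eq_det]
  have e : (∑ _x : Fin n, Finsupp.single (0 : Fin 1) 1) = Finsupp.single (0 : Fin 1) n := by
    simp
  rw [e] at h
  rw [h]
  simp [Fintype.sum_option, diagConfig]

/-- **The principal coefficient of the cuspidal form of an iterated circuit.**
Let `A` be an iterated circuit: an upper diagonal point configuration (first row all
ones, first column `(1,0,…,0)ᵀ`, diagonal blocks `Ã_j`, zero blocks below the diagonal,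
arbitrary blocks above) all of whose diagonal configurations `A_j` are circuits
(codimension one and not pyramids).  Then for a suitable Gale dual `B` of `A`, the
coefficient of `t₁^{n₁} ⋯ t_m^{n_m}` in `P_A` equals the product of the (nonzero)
coefficients of the monomial cuspidal forms `P_{A_j}(t_j)`; in particular `P_A ≠ 0`. -/
theorem iterated_circuit_coeff {r : ℕ} {nn : Fin r → ℕ}
    (At : ∀ j, Matrix (Fin (nn j)) (Fin (nn j + 1)) ℝ)
    (A : Matrix (Option (Σ j, Fin (nn j))) (Option (Σ j : Fin r, Fin (nn j + 1))) ℝ)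
    (hA1 : ∀ k, A none k = 1)
    (hAcol0 : ∀ i, A (some i) none = 0)
    (hAdiag : ∀ (j : Fin r) p q, A (some ⟨j, p⟩) (some ⟨j, q⟩) = At j p q)
    (hAlow : ∀ (j j' : Fin r) p q, j' < j → A (some ⟨j, p⟩) (some ⟨j', q⟩) = 0)
    (hArank : A.rank = Fintype.card (Option (Σ j, Fin (nn j))))
    (hcircuit : ∀ j, (diagConfig (At j)).rank = nn j + 1 ∧ ¬ IsPyramid (diagConfig (At j)))
    (Bj : ∀ j, Matrix (Option (Fin (nn j + 1))) (Fin 1) ℝ)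
    (hGalej : ∀ j, IsGaleDual (diagConfig (At j)) (Bj j)) :
    ∃ B : Matrix (Option (Σ j : Fin r, Fin (nn j + 1))) (Σ _j : Fin r, Fin 1) ℝ,
      IsGaleDual A B ∧
      MvPolynomial.coeff (Finsupp.equivFunOnFinite.symm
          (fun x : (Σ _j : Fin r, Fin 1) => nn x.1))
        (cuspFormPoly (A.submatrix some id) B) =
        ∏ j, MvPolynomial.coeff (Finsupp.single (0 : Fin 1) (nn j))
          (cuspFormPoly ((diagConfig (At j)).submatrix some id) (Bj j)) ∧
      (∀ j, MvPolynomial.coeff (Finsupp.single (0 : Fin 1) (nn j))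
          (cuspFormPoly ((diagConfig (At j)).submatrix some id) (Bj j)) ≠ 0) ∧
      cuspFormPoly (A.submatrix some id) B ≠ 0 := by
  classical
  have hbne : ∀ j k, Bj j k 0 ≠ 0 := by
    intro j
    have hker : diagConfig (At j) *ᵥ (fun k => Bj j k 0) = 0 := by
      funext i
      exact congrFun (congrFun (hGalej j).2 i) 0
    intro k hk
    have h0 := circuit_ker (At j) (hcircuit j).2 _ hker k hk
    have hB : Bj j = 0 := by
      ext k l
      rw [Subsingleton.elim l 0]
      exact congrFun h0 k
    have := (hGalej j).1
    rw [hB, Matrix.rank_zero] at this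
    simp at this
  have hnz : ∀ j, (Matrix.of fun p p' => ∑ q, At j p q * At j p' q * Bj j (some q) 0).det ≠ 0 := by
    intro j
    have hker : diagConfig (At j) *ᵥ (fun k => Bj j k 0) = 0 := by
      funext i
      exact congrFun (congrFun (hGalej j).2 i) 0
    refine circuit_det (At j) (hcircuit j).1 (hcircuit j).2 (fun k => Bj j k 0) hker ?_
    intro h
    exact hbne j none (congrFun h none)
  have hcol : ∀ j : Fin r, ∃ x : (Σ j : Fin r, Fin (nn j + 1)) → ℝ,
      (∀ i q, j < i → x ⟨i, q⟩ = 0) ∧ (∀ q, x ⟨j, q⟩ = Bj j (some q) 0) ∧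
      ∀ i, ∑ k, A (some i) (some k) * x k = 0 := by
    intro j
    have step : ∀ m : ℕ, m ≤ j.val → ∃ x : (Σ j : Fin r, Fin (nn j + 1)) → ℝ,
      (∀ i q, j < i → x ⟨i, q⟩ = 0) ∧ (∀ q, x ⟨j, q⟩ = Bj j (some q) 0) ∧
      ∀ i p, j.val - m ≤ i.val → ∑ k, A (some ⟨i, p⟩) (some k) * x k = 0 := by
      intro m
      induction m with
      | zero =>
        intro _
        refine ⟨fun k => if h : k.1 = j then Bj j (some (h ▸ k.2)) 0 else 0, ?_, ?_, ?_⟩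
        · intro i q hi
          simp [hi.ne']
        · intro q; simp
        · intro i p hi
          rw [Fintype.sum_sigma]
          rw [Finset.sum_eq_single j]
          · simp only [dif_pos]
            rcases (show j ≤ i from hi).lt_or_eq with h | h
            · exact Finset.sum_eq_zero fun q _ => by rw [hAlow _ _ _ _ h, zero_mul]
            · subst h
              have := congrFun (congrFun (hGalej j).2 (some p)) 0
              simp only [Matrix.mul_apply, Fintype.sum_option, diagConfig, Matrix.of_apply,
                zero_mul, zero_add, Matrix.zero_apply] at this
              rw [← this]
              exact Finset.sum_congr rfl fun q _ => by rw [hAdiag]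
          · intro b _ hb
            simp [hb]
          · intro h; exact absurd (mem_univ _) h
      | succ m ih =>
        intro hm
        obtain ⟨x, hx1, hx2, hx3⟩ := ih (by omega)
        let i0 : Fin r := ⟨j.val - (m + 1), by omega⟩
        have hi0 : i0 < j := by
          rw [Fin.lt_def]; simp only [i0]; omega
        obtain ⟨y, hy⟩ := circuit_surj (At i0) (hcircuit i0).1
          (fun p => - ∑ k, A (some ⟨i0, p⟩) (some k) * x k)
        have hsum : ∀ i p, ∑ k : (Σ j : Fin r, Fin (nn j + 1)), A (some ⟨i, p⟩) (some k) *
            (x k + if h : k.1 = i0 then y (h ▸ k.2) else 0)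
            = ∑ k, A (some ⟨i, p⟩) (some k) * x k +
              ∑ q, A (some ⟨i, p⟩) (some ⟨i0, q⟩) * y q := by
          intro i p
          simp only [mul_add, Finset.sum_add_distrib]
          congr 1
          rw [Fintype.sum_sigma, Finset.sum_eq_single i0]
          · simp
          · intro b _ hb
            simp [hb]
          · intro h; exact absurd (mem_univ _) h
        refine ⟨fun k => x k + if h : k.1 = i0 then y (h ▸ k.2) else 0, ?_, ?_, ?_⟩
        · intro i q hi
          simp [hx1 i q hi, (hi0.trans hi).ne']
        · intro q
          simp [hx2 q, hi0.ne']
        · intro i p hi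
          rw [hsum]
          rcases (show i0 ≤ i from hi).lt_or_eq with h | h
          · rw [hx3 i p (by rw [Fin.lt_def] at h; simp only [i0] at h; omega), zero_add]
            exact Finset.sum_eq_zero fun q _ => by rw [hAlow _ _ _ _ h, zero_mul]
          · subst h
            have := congrFun hy p
            simp only [Matrix.mulVec, dotProduct] at this
            simp only [hAdiag]
            rw [this]
            ring
    obtain ⟨x, h1, h2, h3⟩ := step j.val le_rfl
    exact ⟨x, h1, h2, fun i => h3 i.1 i.2 (by omega)⟩
  choose x hx1 hx2 hx3 using hcol
  let B : Matrix (Option (Σ j : Fin r, Fin (nn j + 1))) (Σ _j : Fin r, Fin 1) ℝ :=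
    Matrix.of fun k l => k.elim (- ∑ k', x l.1 k') (fun k' => x l.1 k')
  have hBs : ∀ k l, B (some k) l = x l.1 k := fun _ _ => rfl
  have hcoeff : MvPolynomial.coeff (Finsupp.equivFunOnFinite.symm
          (fun x : (Σ _j : Fin r, Fin 1) => nn x.1))
        (cuspFormPoly (A.submatrix some id) B) =
        ∏ j, MvPolynomial.coeff (Finsupp.single (0 : Fin 1) (nn j))
          (cuspFormPoly ((diagConfig (At j)).submatrix some id) (Bj j)) := by
    simp_rw [circuit_form]
    have hexp : (Finsupp.equivFunOnFinite.symm (fun x : (Σ _j : Fin r, Fin 1) => nn x.1))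
        = ∑ z : (Σ j : Fin r, Fin (nn j)),
          Finsupp.single (⟨z.1, 0⟩ : Σ _j : Fin r, Fin 1) 1 := by
      ext ⟨j, l⟩
      rw [Subsingleton.elim l 0]
      rw [Finsupp.finsetSum_apply, Fintype.sum_sigma, Finset.sum_eq_single j]
      · simp
      · intro b _ hb
        refine Finset.sum_eq_zero fun p _ => ?_
        rw [Finsupp.single_apply, if_neg]
        intro h
        exact hb (congrArg Sigma.fst h)
      · intro h; exact absurd (mem_univ _) h
    have hlow : ∀ (z : Σ j : Fin r, Fin (nn j)) (k : Σ j : Fin r, Fin (nn j + 1)),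
        k.1 < z.1 → A (some z) (some k) = 0 := fun z k h => hAlow z.1 k.1 z.2 k.2 h
    rw [cuspFormPoly_eq_det, hexp, coeff_det_lin _ _ (fun l => l.1.val)]
    · have hbt : (Matrix.of fun z z' : (Σ j : Fin r, Fin (nn j)) =>
          ∑ k, A.submatrix some id z k * A.submatrix some id z' k *
            B k ⟨z.1, 0⟩).BlockTriangular (fun z => OrderDual.toDual z.1) := by
        intro z z' hzz
        have hzz' : z.1 < z'.1 := hzz
        simp only [Matrix.of_apply, Matrix.submatrix_apply, id, Fintype.sum_option, hAcol0,
          zero_mul, zero_add, hBs]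
        refine Finset.sum_eq_zero fun k _ => ?_
        rcases lt_or_ge k.1 z'.1 with h | h
        · rw [hlow z' k h]; ring
        · rw [show x z.1 k = 0 from hx1 z.1 k.1 k.2 (hzz'.trans_le h), mul_zero]
      rw [hbt.det_fintype]
      refine Fintype.prod_equiv OrderDual.ofDual _ _ ?_
      intro j
      let e : Fin (nn (OrderDual.ofDual j)) ≃
          {z : (Σ j : Fin r, Fin (nn j)) // OrderDual.toDual z.1 = j} :=
        { toFun := fun p => ⟨⟨OrderDual.ofDual j, p⟩, rfl⟩
          invFun := fun z => (congrArg OrderDual.ofDual z.2) ▸ z.1.2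
          left_inv := fun p => rfl
          right_inv := by
            rintro ⟨⟨a, p⟩, h⟩
            subst h
            rfl }
      rw [← Matrix.det_submatrix_equiv_self e]
      congr 1
      ext p p'
      simp only [Matrix.toSquareBlock, Matrix.toSquareBlockProp, Matrix.submatrix_apply,
        Matrix.of_apply, id, Fintype.sum_option, hAcol0, Matrix.toBlock_apply,
          zero_mul, zero_add, hBs]
      simp only [e, Equiv.coe_fn_mk]
      rw [Fintype.sum_sigma, Finset.sum_eq_single (OrderDual.ofDual j)]
      · exact Finset.sum_congr rfl fun q _ => by rw [hAdiag, hAdiag, hx2]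
      · intro b _ hb
        refine Finset.sum_eq_zero fun q _ => ?_
        rcases lt_or_gt_of_ne hb with h | h
        · rw [hAlow _ _ _ _ h]; ring
        · rw [hx1 _ _ _ h, mul_zero]
      · intro h; exact absurd (mem_univ _) h
    · rintro z z' ⟨l, l'⟩ hne
      rw [Subsingleton.elim l' 0]
      by_contra hcon
      push Not at hcon
      obtain ⟨hc1, hc2⟩ := hcon
      have hlz : l < z.1 := by
        refine lt_of_le_of_ne hc2 ?_
        intro h
        exact hc1 (by rw [h])
      apply hne
      simp only [Matrix.submatrix_apply, id, Fintype.sum_option, hAcol0,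
          zero_mul, zero_add, hBs]
      refine Finset.sum_eq_zero fun k _ => ?_
      rcases lt_or_ge k.1 z.1 with h | h
      · rw [hlow z k h]; ring
      · rw [show x l k = 0 from hx1 l k.1 k.2 (hlz.trans_le h), mul_zero]
  refine ⟨B, ⟨?_, ?_⟩, hcoeff, ?_, ?_⟩
  · have hinj : Function.Injective B.mulVecLin := by
      rw [← LinearMap.ker_eq_bot, LinearMap.ker_eq_bot']
      intro v hv
      have hv' : ∀ k, ∑ l, B k l * v l = 0 := fun k => congrFun hv k
      have key : ∀ m : ℕ, ∀ j : Fin r, r - j.val = m → v ⟨j, 0⟩ = 0 := by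
        intro m
        induction m using Nat.strong_induction_on with
        | _ m ih =>
          intro j hj
          have h := hv' (some ⟨j, 0⟩)
          rw [Fintype.sum_sigma, Finset.sum_eq_single j] at h
          · simp only [hBs, hx2, Finset.univ_unique, Finset.sum_singleton] at h
            exact (mul_eq_zero.mp h).resolve_left (hbne _ _)
          · intro b _ hb
            refine Finset.sum_eq_zero fun q _ => ?_
            rw [Subsingleton.elim q 0]
            rcases lt_or_gt_of_ne hb with h | h
            · rw [hBs, hx1 _ _ _ h, zero_mul]
            · rw [ih (r - b.val) (by have := b.2; rw [Fin.lt_def] at h; omega) b rfl,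
                mul_zero]
          · intro h; exact absurd (mem_univ _) h
      funext ⟨j, l⟩
      rw [Subsingleton.elim l 0]
      exact key _ j rfl
    rw [Matrix.rank, LinearMap.finrank_range_of_inj hinj, Module.finrank_fintype_fun_eq_card]
  · ext i l
    rw [Matrix.mul_apply, Fintype.sum_option, Matrix.zero_apply]
    rcases i with _ | i
    · simp only [hA1, one_mul, hBs]
      simp [B]
    · rw [hAcol0, zero_mul, zero_add]
      exact hx3 l.1 i
  · intro j
    rw [circuit_form]
    exact hnz j
  · intro h0
    rw [h0, MvPolynomial.coeff_zero] at hcoeff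
    refine Finset.prod_ne_zero_iff.mpr ?_ hcoeff.symm
    intro j _
    rw [circuit_form]
    exact hnz j
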